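/- Let 𝒟 be a set of curves without endpoints (i.e. curves indexed by ℤ) such that Γ^n(𝒟) is defined for every n ∈ ℕ. Then 𝒟 consists of at most 27 curves. -/

import Mathlib

namespace Folding

noncomputable section

open Set

/-- Points of `ℝ^n` with the euclidean distance. -/
abbrev Pt (n : ℕ) := EuclideanSpace ℝ (Fin n)

/-- `p` is a point of the lattice `ℤ^n`. -/
def latt {n : ℕ} (p : Pt n) : Prop := ∀ i, ∃ m : ℤ, p i = (m : ℝ)

/-- `p` belongs to `m·ℤ^n`. -/
def inLat {n : ℕ} (m : ℕ) (p : Pt n) : Prop := ∀ i, ∃ c : ℤ, p i = (m : ℝ) * (c : ℝ)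

/-- The canonical basis vector `e_i`. -/
def uvec (n : ℕ) (i : Fin n) : Pt n := EuclideanSpace.single i (1 : ℝ)

/-- `u` belongs to `E = {e_1, -e_1, …, e_n, -e_n}`. -/
def IsDir {n : ℕ} (u : Pt n) : Prop := ∃ i, u = uvec n i ∨ u = -uvec n i

/-- A (nonoriented) lattice segment `[x, x + e_i]`, as an unordered pair of endpoints. -/
def IsSeg {n : ℕ} (S : Sym2 (Pt n)) : Prop := ∃ x i, latt x ∧ S = s(x, x + uvec n i)

/-- A curve: a sequence of segments, indexed by an interval of `ℤ` (finite, ℕ-like or ℤ-like),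
recorded through its sequence of vertices; two consecutive segments have exactly one common
endpoint, and the common endpoints with the preceding and the following segments differ
(`noback`). -/
structure Curve (n : ℕ) where
  dom : Set ℤ
  ordConn : dom.OrdConnected
  nontriv : ∃ i, i ∈ dom ∧ i + 1 ∈ dom
  v : ℤ → Pt n
  lattice : ∀ i ∈ dom, latt (v i)
  step : ∀ i : ℤ, i ∈ dom → i + 1 ∈ dom →
    ∃ j, v (i + 1) = v i + uvec n j ∨ v (i + 1) = v i - uvec n j
  noback : ∀ i : ℤ, i - 1 ∈ dom → i + 1 ∈ dom → v (i + 1) ≠ v (i - 1)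

namespace Curve

variable {n : ℕ} (c : Curve n)

/-- The segments of a curve. -/
def segs : Set (Sym2 (Pt n)) :=
  {S | ∃ i : ℤ, i ∈ c.dom ∧ i + 1 ∈ c.dom ∧ S = s(c.v i, c.v (i + 1))}

/-- The connexions between segments of a curve: pairs of consecutive segments. -/
def conn (S T : Sym2 (Pt n)) : Prop :=
  ∃ i : ℤ, i - 1 ∈ c.dom ∧ i + 1 ∈ c.dom ∧
    ((S = s(c.v (i - 1), c.v i) ∧ T = s(c.v i, c.v (i + 1))) ∨
     (T = s(c.v (i - 1), c.v i) ∧ S = s(c.v i, c.v (i + 1))))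

/-- A curve is self-avoiding if each of its segments appears only once. -/
def SelfAvoiding : Prop :=
  ∀ i j : ℤ, i ∈ c.dom → i + 1 ∈ c.dom → j ∈ c.dom → j + 1 ∈ c.dom →
    s(c.v i, c.v (i + 1)) = s(c.v j, c.v (j + 1)) → i = j

/-- A curve without endpoints (indexed by `ℤ`). -/
def NoEndpts : Prop := c.dom = Set.univ

/-- `p` is an endpoint of the curve `c`. -/
def IsEndpt (p : Pt n) : Prop :=
  ∃ i ∈ c.dom, p = c.v i ∧ (i - 1 ∉ c.dom ∨ i + 1 ∉ c.dom)

/-- `S` is the end segment of `c` at its endpoint `p`. -/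
def endSegAt (p : Pt n) (S : Sym2 (Pt n)) : Prop :=
  ∃ i : ℤ, i ∈ c.dom ∧ p = c.v i ∧
    ((i - 1 ∉ c.dom ∧ i + 1 ∈ c.dom ∧ S = s(c.v i, c.v (i + 1))) ∨
     (i + 1 ∉ c.dom ∧ i - 1 ∈ c.dom ∧ S = s(c.v (i - 1), c.v i)))

/-- The number of segments (length) of a curve. -/
def nsegs : ℕ := {i : ℤ | i ∈ c.dom ∧ i + 1 ∈ c.dom}.ncard

end Curve

/-- The trace of a set of curves: its set of segments together with the connexion
relation between segments.  Two sets of curves are geometrically the same set of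
(nonoriented) curves iff they have the same trace. -/
structure Trace (n : ℕ) where
  segs : Set (Sym2 (Pt n))
  conn : Sym2 (Pt n) → Sym2 (Pt n) → Prop

def curveTrace {n : ℕ} (c : Curve n) : Trace n := ⟨c.segs, c.conn⟩

def traceOf {n : ℕ} (E : Set (Curve n)) : Trace n :=
  ⟨{S | ∃ c ∈ E, S ∈ c.segs}, fun S T => ∃ c ∈ E, c.conn S T⟩

/-- Two curves are the same nonoriented curve. -/
def SameCurve {n : ℕ} (c d : Curve n) : Prop := c.segs = d.segs ∧ c.conn = d.conn

/-- A set of pairwise disjoint self-avoiding curves. -/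
def DisjSA {n : ℕ} (E : Set (Curve n)) : Prop :=
  (∀ c ∈ E, c.SelfAvoiding) ∧
  ∀ c ∈ E, ∀ d ∈ E, ¬ SameCurve c d → ∀ S, S ∈ c.segs → S ∉ d.segs

/-- The set of points of `ℝ^n` lying on the segment `S`. -/
def segPts {n : ℕ} (S : Sym2 (Pt n)) : Set (Pt n) :=
  {p | ∃ a b, S = s(a, b) ∧ ∃ t : ℝ, 0 ≤ t ∧ t ≤ 1 ∧ p = a + t • (b - a)}

def Trace.pts {n : ℕ} (T : Trace n) : Set (Pt n) := ⋃ S ∈ T.segs, segPts S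

/-- A set of curves covers `X ⊆ ℝ^n`: each lattice segment containing a point of `X`
appears in one and only one of the curves. -/
def Covers {n : ℕ} (E : Set (Curve n)) (X : Set (Pt n)) : Prop :=
  ∀ S, IsSeg S → (segPts S ∩ X).Nonempty →
    (∃ c ∈ E, S ∈ c.segs) ∧ ∀ c ∈ E, ∀ d ∈ E, S ∈ c.segs → S ∈ d.segs → SameCurve c d

/-- A covering of `ℝ^n` by disjoint self-avoiding curves. -/
def IsCovering {n : ℕ} (E : Set (Curve n)) : Prop := DisjSA E ∧ Covers E Set.univ

/-- A single curve covers `X`. -/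
def CurveCovers {n : ℕ} (c : Curve n) (X : Set (Pt n)) : Prop :=
  ∀ S, IsSeg S → (segPts S ∩ X).Nonempty → S ∈ c.segs

/-- `b` is a curve contained in the curve `a`. -/
def SubCurve {n : ℕ} (b a : Curve n) : Prop :=
  b.segs ⊆ a.segs ∧ ∀ S T, b.conn S T → a.conn S T

/-- The relation `≺` at the level of traces. -/
def TPrec {n : ℕ} (T T' : Trace n) : Prop :=
  T.segs ⊆ T'.segs ∧ ∀ S S', T.conn S S' → T'.conn S S'

/-- `E ≺ F` : each segment of a curve of `E` is a segment of a curve of `F` and each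
connexion between two segments of a curve of `E` also exists in `F`. -/
def Prec {n : ℕ} (E F : Set (Curve n)) : Prop := TPrec (traceOf E) (traceOf F)

/-- Image of a trace under a map of `ℝ^n`. -/
def Trace.map {n : ℕ} (f : Pt n → Pt n) (T : Trace n) : Trace n :=
  ⟨Sym2.map f '' T.segs,
   fun S S' => ∃ A B, T.conn A B ∧ S = Sym2.map f A ∧ S' = Sym2.map f B⟩

/-- Translation of a trace by the vector `t`. -/
def Trace.transl {n : ℕ} (t : Pt n) (T : Trace n) : Trace n := T.map (fun p => p + t)

/-- Property (H) for the pair `(k, l)`. -/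
def SatH {n : ℕ} (A : Set (Curve n)) (k l : ℕ) : Prop :=
  0 < k ∧ 0 < l ∧ k ∣ l ∧ IsCovering A ∧
  (∀ c ∈ A, c.dom.Finite ∧ ∃ x i, latt x ∧ inLat k x ∧ c.IsEndpt x ∧
      c.IsEndpt (x + (k : ℝ) • uvec n i) ∧
      ∀ p, c.IsEndpt p → p = x ∨ p = x + (k : ℝ) • uvec n i) ∧
  (∀ (x : Pt n) (i : Fin n), latt x → inLat k x →
      (∃ c ∈ A, c.IsEndpt x ∧ c.IsEndpt (x + (k : ℝ) • uvec n i)) ∧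
      ∀ c ∈ A, ∀ d ∈ A, c.IsEndpt x → c.IsEndpt (x + (k : ℝ) • uvec n i) →
        d.IsEndpt x → d.IsEndpt (x + (k : ℝ) • uvec n i) → SameCurve c d) ∧
  (∀ t : Pt n, inLat l t → Trace.transl t (traceOf A) = traceOf A)

/-- The trace of the convolution product `A ∗ B`, where `A` satisfies (H) for `(k, l)`:
apply to `B` the homothety of center `0` and ratio `k`, then replace each resulting
segment by the curve of `A` having the same endpoints (connexions come from the curves
of `A`, together with the junctions of the end segments of consecutive `A`-curves). -/
def ConvTrace {n : ℕ} (k : ℕ) (A B : Set (Curve n)) : Trace n where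
  segs := {S | ∃ a b : Pt n, s(a, b) ∈ (traceOf B).segs ∧
    ∃ c ∈ A, c.IsEndpt ((k : ℝ) • a) ∧ c.IsEndpt ((k : ℝ) • b) ∧ S ∈ c.segs}
  conn := fun S S' =>
    (∃ a b : Pt n, s(a, b) ∈ (traceOf B).segs ∧
      ∃ c ∈ A, c.IsEndpt ((k : ℝ) • a) ∧ c.IsEndpt ((k : ℝ) • b) ∧ c.conn S S') ∨
    (∃ a b d : Pt n, (traceOf B).conn s(a, b) s(b, d) ∧
      ∃ c ∈ A, ∃ c' ∈ A, c.IsEndpt ((k : ℝ) • a) ∧ c.IsEndpt ((k : ℝ) • b) ∧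
        c'.IsEndpt ((k : ℝ) • b) ∧ c'.IsEndpt ((k : ℝ) • d) ∧
        ((c.endSegAt ((k : ℝ) • b) S ∧ c'.endSegAt ((k : ℝ) • b) S') ∨
         (c.endSegAt ((k : ℝ) • b) S' ∧ c'.endSegAt ((k : ℝ) • b) S)))

/-- The two-sided identity of the convolution product: the covering consisting of all
curves with one segment. -/
def unitTrace (n : ℕ) : Trace n := ⟨{S | IsSeg S}, fun _ _ => False⟩

/-- `P s` realizes the power `A^s` for the convolution product. -/
def PowersOf {n : ℕ} (A : Set (Curve n)) (k : ℕ) (P : ℕ → Set (Curve n)) : Prop :=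
  (∀ s, DisjSA (P s)) ∧ traceOf (P 0) = unitTrace n ∧
  ∀ s, traceOf (P (s + 1)) = ConvTrace k A (P s)

/-- The trace of `Â`, the inductive limit of the `A^s` for `≺`. -/
def hatTrace {n : ℕ} (P : ℕ → Set (Curve n)) : Trace n :=
  ⟨{S | ∃ s, S ∈ (traceOf (P s)).segs}, fun S T => ∃ s, (traceOf (P s)).conn S T⟩

/-- A pairing relation on `E = {e_1, -e_1, …, e_n, -e_n}`. -/
def IsPairing {n : ℕ} (R : Pt n → Pt n → Prop) : Prop :=
  (∀ u v, R u v → R v u) ∧ (∀ u v, R u v → IsDir u ∧ IsDir v) ∧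
  (∀ u, ¬ R u u) ∧ ∀ u, IsDir u → ∃! v, R u v

/-- The trace of `Â_R` : `Â` with the segments with endpoint `0` connected according
to `R`. -/
def hatRTrace {n : ℕ} (P : ℕ → Set (Curve n)) (R : Pt n → Pt n → Prop) : Trace n :=
  ⟨(hatTrace P).segs,
   fun S T => (hatTrace P).conn S T ∨
     ∃ u v, R u v ∧ S = s((0 : Pt n), u) ∧ T = s((0 : Pt n), v)⟩

/-- The cube `P_{x,h}`. -/
def cube {n : ℕ} (x : Pt n) (h : ℕ) : Set (Pt n) :=
  {p | ∀ i, x i - h ≤ p i ∧ p i ≤ x i + h}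

/-- Restriction of a trace to a region `X` of `ℝ^n`. -/
def Trace.restr {n : ℕ} (T : Trace n) (X : Set (Pt n)) : Trace n :=
  ⟨{S | S ∈ T.segs ∧ segPts S ⊆ X},
   fun S S' => T.conn S S' ∧ segPts S ⊆ X ∧ segPts S' ⊆ X⟩

/-- Condition (C). -/
def CondC {n : ℕ} (T : Trace n) : Prop :=
  ∀ (x : Pt n) (h : ℕ), latt x → 1 ≤ h →
    ∃ y : Pt n, latt y ∧ y ∉ cube x h ∧
      Trace.transl (y - x) (T.restr (cube x h)) = T.restr (cube y h)

/-- `(B(x,r) ∩ T, x) ≅ (B(y,r) ∩ T', y)` : the translation sending `x` to `y` maps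
the part of `T` in the closed ball `B(x,r)` onto the part of `T'` in `B(y,r)`,
preserving the connexions between segments. -/
def BallIso {n : ℕ} (T : Trace n) (x : Pt n) (T' : Trace n) (y : Pt n) (r : ℝ) : Prop :=
  (fun p => p + (y - x)) '' (T.pts ∩ Metric.closedBall x r) =
      T'.pts ∩ Metric.closedBall y r ∧
  (∀ S S', T.conn S S' → segPts S ⊆ Metric.closedBall x r →
      segPts S' ⊆ Metric.closedBall x r →
      T'.conn (Sym2.map (fun p => p + (y - x)) S) (Sym2.map (fun p => p + (y - x)) S')) ∧
  (∀ S S', T'.conn S S' → segPts S ⊆ Metric.closedBall y r →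
      segPts S' ⊆ Metric.closedBall y r →
      T.conn (Sym2.map (fun p => p + (x - y)) S) (Sym2.map (fun p => p + (x - y)) S'))

/-- The local isomorphism property. -/
def LocIsoProp {n : ℕ} (T : Trace n) : Prop :=
  ∀ (x : Pt n) (r : ℝ), 0 ≤ r →
    ∃ t : ℝ, 0 ≤ t ∧ ∀ y : Pt n, ∃ z ∈ Metric.closedBall y t, BallIso T x T z r

/-- Two traces are locally isomorphic. -/
def LocallyIso {n : ℕ} (T T' : Trace n) : Prop :=
  (∀ (x : Pt n) (r : ℝ), 0 ≤ r → ∃ y, BallIso T x T' y r) ∧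
  (∀ (y : Pt n) (r : ℝ), 0 ≤ r → ∃ x, BallIso T' y T x r)

/-- `Ω_{s,x}` : suppress the connexions between segments whose common endpoint lies in
`x + k^s ℤ^n`. -/
def OmegaTrace {n : ℕ} (k s : ℕ) (x : Pt n) (T : Trace n) : Trace n :=
  ⟨T.segs, fun S S' => T.conn S S' ∧ ¬ ∃ p, p ∈ S ∧ p ∈ S' ∧ inLat (k ^ s) (p - x)⟩

/-- `Σ_{s,x}(E)` : for each curve `D` of `E` passing through `x`, the curve(s) with
endpoint `x` contained in `D` having maximal length, this length being limited to
`8^s`. -/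
def SigmaSet {n : ℕ} (s : ℕ) (x : Pt n) (E : Set (Curve n)) : Set (Curve n) :=
  {b | ∃ D ∈ E, SubCurve b D ∧ b.IsEndpt x ∧ b.nsegs ≤ 8 ^ s ∧
    ∀ b' : Curve n, SubCurve b' D → b'.IsEndpt x → b'.nsegs ≤ 8 ^ s →
      SubCurve b b' → SameCurve b b'}

/-- A positive (orientation preserving) isometry of `ℝ^n`. -/
def PosIsom {n : ℕ} (f : Pt n → Pt n) : Prop :=
  ∃ (g : Pt n ≃ₗᵢ[ℝ] Pt n) (t : Pt n), (∀ x, f x = g x + t) ∧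
    0 < LinearMap.det (g.toLinearEquiv.toLinearMap)

/-- `E` consists of exactly `m` curves. -/
def HasExactly {n : ℕ} (E : Set (Curve n)) (m : ℕ) : Prop :=
  ∃ L : List (Curve n), L.length = m ∧ (∀ c ∈ L, c ∈ E) ∧
    L.Pairwise (fun c d => ¬ SameCurve c d) ∧ ∀ c ∈ E, ∃ d ∈ L, SameCurve c d

/-- `E` consists of at most `m` curves. -/
def AtMost {n : ℕ} (E : Set (Curve n)) (m : ℕ) : Prop :=
  ∃ L : List (Curve n), L.length ≤ m ∧ ∀ c ∈ E, ∃ d ∈ L, SameCurve c d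

/-- The set of points of a curve. -/
def curvePts {n : ℕ} (c : Curve n) : Set (Pt n) := ⋃ S ∈ c.segs, segPts S

-- ℝ³-specific part
def toPt3 (f : Fin 3 → ℝ) : Pt 3 := (WithLp.equiv 2 (Fin 3 → ℝ)).symm f

def p3 (a b c : ℤ) : Pt 3 := toPt3 ![(a : ℝ), (b : ℝ), (c : ℝ)]

/-- The vertices of the curve `C`. -/
def CList : List (Pt 3) :=
  [p3 0 0 0, p3 0 (-1) 0, p3 0 (-1) (-1), p3 0 0 (-1), p3 1 0 (-1),
   p3 1 (-1) (-1), p3 1 (-1) 0, p3 1 0 0, p3 2 0 0]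

/-- The block `ℬ₀` : six curves given by their lists of successive vertices. -/
def B0 : List (List (Pt 3)) :=
  [ CList,
    [p3 0 0 0, p3 0 0 1, p3 0 1 1, p3 0 1 0, p3 (-1) 1 0, p3 (-1) 1 1,
     p3 (-1) 0 1, p3 (-1) 0 0, p3 (-2) 0 0],
    [p3 0 0 0, p3 0 0 (-1), p3 (-1) 0 (-1), p3 (-1) 0 0, p3 (-1) 1 0,
     p3 (-1) 1 (-1), p3 0 1 (-1), p3 0 1 0, p3 0 2 0],
    [p3 0 0 0, p3 1 0 0, p3 1 0 1, p3 0 0 1, p3 0 (-1) 1, p3 1 (-1) 1,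
     p3 1 (-1) 0, p3 0 (-1) 0, p3 0 (-2) 0],
    [p3 0 0 0, p3 (-1) 0 0, p3 (-1) (-1) 0, p3 0 (-1) 0, p3 0 (-1) 1,
     p3 (-1) (-1) 1, p3 (-1) 0 1, p3 0 0 1, p3 0 0 2],
    [p3 0 0 0, p3 0 1 0, p3 1 1 0, p3 1 0 0, p3 1 0 (-1), p3 1 1 (-1),
     p3 0 1 (-1), p3 0 0 (-1), p3 0 0 (-2)] ]

def sigma3 : Pt 3 → Pt 3 := fun x => toPt3 ![x 0, -(x 1), -(x 2)]
def tau3 : Pt 3 → Pt 3 := fun x => toPt3 ![x 0, x 2, -(x 1)]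
def ups3 : Pt 3 → Pt 3 := fun x => toPt3 ![x 0, -(x 2), x 1]

/-- The four blocks `ℬ₀, ℬ₁, ℬ₂, ℬ₃`. -/
def blockLists : Fin 4 → List (List (Pt 3)) :=
  ![B0,
    B0.map (List.map fun p => p3 2 2 0 + sigma3 p),
    B0.map (List.map fun p => p3 2 0 2 + tau3 p),
    B0.map (List.map fun p => p3 0 2 2 + ups3 p)]

def listSegs (L : List (Pt 3)) : Set (Sym2 (Pt 3)) :=
  {S | ∃ j : ℕ, j + 1 < L.length ∧ S = s(L.getD j 0, L.getD (j + 1) 0)}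

def listConn (L : List (Pt 3)) (S T : Sym2 (Pt 3)) : Prop :=
  ∃ j : ℕ, j + 2 < L.length ∧
    ((S = s(L.getD j 0, L.getD (j + 1) 0) ∧ T = s(L.getD (j + 1) 0, L.getD (j + 2) 0)) ∨
     (T = s(L.getD j 0, L.getD (j + 1) 0) ∧ S = s(L.getD (j + 1) 0, L.getD (j + 2) 0)))

/-- The trace of the curve given by a list of successive vertices. -/
def listTrace (L : List (Pt 3)) : Trace 3 := ⟨listSegs L, listConn L⟩

/-- The trace of the covering `𝒞 = ⋃_{u ∈ ℤ³, 0 ≤ i ≤ 3} (4u + ℬ_i)`. -/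
def CTrace : Trace 3 where
  segs := {S | ∃ u : Pt 3, latt u ∧ ∃ (i : Fin 4), ∃ M ∈ blockLists i,
    S ∈ (Trace.transl ((4 : ℝ) • u) (listTrace M)).segs}
  conn := fun S T => ∃ u : Pt 3, latt u ∧ ∃ (i : Fin 4), ∃ M ∈ blockLists i,
    (Trace.transl ((4 : ℝ) • u) (listTrace M)).conn S T

open Classical in
/-- The permutation `θ` of `E` with `θ(e₁) = -e₂`, `θ(e₂) = -e₃`, `θ(e₃) = -e₁`
and `θ² = Id`. -/
def theta3 : Pt 3 → Pt 3 := fun u =>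
  if u = uvec 3 0 then -uvec 3 1
  else if u = -uvec 3 1 then uvec 3 0
  else if u = uvec 3 1 then -uvec 3 2
  else if u = -uvec 3 2 then uvec 3 1
  else if u = uvec 3 2 then -uvec 3 0
  else if u = -uvec 3 0 then uvec 3 2
  else u

/-- `R^θ`. -/
def Rtheta (R : Pt 3 → Pt 3 → Prop) : Pt 3 → Pt 3 → Prop :=
  fun u v => R (theta3 u) (theta3 v)

def Rx (P : ℕ → Set (Curve 3)) (x : Pt 3) : Pt 3 → Pt 3 → Prop :=
  fun u v => (hatTrace P).conn s(x, x + u) s(x, x + v)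

/-- Condition (P). -/
def SatP (P : ℕ → Set (Curve 3)) (R : Pt 3 → Pt 3 → Prop) : Prop :=
  ∃ x : Pt 3, (∀ i, x i = -2 ∨ x i = 0 ∨ x i = 2 ∨ x i = 4) ∧
    (¬ ∀ i, x i = 0 ∨ x i = 4) ∧ (Rx P x = R ∨ Rx P x = Rtheta R)

/-- The trace of `Ĉ_X`, the inductive limit of the sets `x_s + 𝒞^s`. -/
def hatXTrace (P : ℕ → Set (Curve 3)) (x : ℕ → Pt 3) : Trace 3 :=
  ⟨{S | ∃ s, 1 ≤ s ∧ S ∈ (Trace.transl (x s) (traceOf (P s))).segs},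
   fun S T => ∃ s, 1 ≤ s ∧ (Trace.transl (x s) (traceOf (P s))).conn S T⟩

/-- The curve `c` is equivalent to `C` (image of `C` by a positive isometry). -/
def EquivToC (c : Curve 3) : Prop :=
  ∃ f, PosIsom f ∧ curveTrace c = Trace.map f (listTrace CList)

/-- `x` is an endpoint of type `0` (resp. `1`) of the curve `c`, for `c`
equivalent to `C`. -/
def EndptType (c : Curve 3) (x : Pt 3) (ty : ℕ) : Prop :=
  ∃ f, PosIsom f ∧ curveTrace c = Trace.map f (listTrace CList) ∧
    x = f (if ty = 0 then p3 0 0 0 else p3 2 0 0)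

/-! ### Integer model of the covering -/

/-- The lattice point of `ℝ³` with the given integer coordinates. -/
def ofZ (x : ℤ × ℤ × ℤ) : Pt 3 := p3 x.1 x.2.1 x.2.2

@[simp] lemma p3_zero (a b c : ℤ) : p3 a b c 0 = a := rfl
@[simp] lemma p3_one (a b c : ℤ) : p3 a b c 1 = b := rfl
@[simp] lemma p3_two (a b c : ℤ) : p3 a b c 2 = c := rfl

lemma Pt3.ext {p q : Pt 3} (h0 : p 0 = q 0) (h1 : p 1 = q 1) (h2 : p 2 = q 2) : p = q := by
  ext i; fin_cases i <;> assumption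

lemma ofZ_add (x y : ℤ × ℤ × ℤ) : ofZ (x + y) = ofZ x + ofZ y := by
  apply Pt3.ext <;> simp [ofZ]

lemma ofZ_smul (n : ℤ) (x : ℤ × ℤ × ℤ) : ofZ (n • x) = (n : ℝ) • ofZ x := by
  apply Pt3.ext <;> simp [ofZ]

lemma ofZ_zero : ofZ 0 = 0 := by
  apply Pt3.ext <;> simp [ofZ]

lemma ofZ_injective : Function.Injective ofZ := by
  intro x y h
  have h0 := congrArg (fun p : Pt 3 => p 0) h
  have h1 := congrArg (fun p : Pt 3 => p 1) h
  have h2 := congrArg (fun p : Pt 3 => p 2) h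
  simp only [ofZ, p3_zero, p3_one, p3_two, Int.cast_inj] at h0 h1 h2
  exact Prod.ext h0 (Prod.ext h1 h2)

lemma latt_iff_exists_ofZ {p : Pt 3} : latt p ↔ ∃ x, p = ofZ x := by
  constructor
  · intro h
    obtain ⟨a, ha⟩ := h 0
    obtain ⟨b, hb⟩ := h 1
    obtain ⟨c, hc⟩ := h 2
    exact ⟨(a, b, c), Pt3.ext ha hb hc⟩
  · rintro ⟨x, rfl⟩ i
    fin_cases i
    exacts [⟨_, rfl⟩, ⟨_, rfl⟩, ⟨_, rfl⟩]

/-- The block `ℬ₀` with integer coordinates. -/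
def B0Z : List (List (ℤ × ℤ × ℤ)) :=
  [ [(0, 0, 0), (0, -1, 0), (0, -1, -1), (0, 0, -1), (1, 0, -1),
     (1, -1, -1), (1, -1, 0), (1, 0, 0), (2, 0, 0)],
    [(0, 0, 0), (0, 0, 1), (0, 1, 1), (0, 1, 0), (-1, 1, 0), (-1, 1, 1),
     (-1, 0, 1), (-1, 0, 0), (-2, 0, 0)],
    [(0, 0, 0), (0, 0, -1), (-1, 0, -1), (-1, 0, 0), (-1, 1, 0),
     (-1, 1, -1), (0, 1, -1), (0, 1, 0), (0, 2, 0)],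
    [(0, 0, 0), (1, 0, 0), (1, 0, 1), (0, 0, 1), (0, -1, 1), (1, -1, 1),
     (1, -1, 0), (0, -1, 0), (0, -2, 0)],
    [(0, 0, 0), (-1, 0, 0), (-1, -1, 0), (0, -1, 0), (0, -1, 1),
     (-1, -1, 1), (-1, 0, 1), (0, 0, 1), (0, 0, 2)],
    [(0, 0, 0), (0, 1, 0), (1, 1, 0), (1, 0, 0), (1, 0, -1), (1, 1, -1),
     (0, 1, -1), (0, 0, -1), (0, 0, -2)] ]

/-- The curves of the four blocks, with integer coordinates. -/
def blocksZ : List (List (ℤ × ℤ × ℤ)) :=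
  B0Z ++ B0Z.map (List.map fun x => (2 + x.1, 2 - x.2.1, -x.2.2)) ++
    B0Z.map (List.map fun x => (2 + x.1, x.2.2, 2 - x.2.1)) ++
    B0Z.map (List.map fun x => (x.1, 2 - x.2.2, 2 + x.2.1))

lemma B0_eq : B0 = B0Z.map (List.map ofZ) := rfl

lemma map_B0_eq {f : Pt 3 → Pt 3} {g : ℤ × ℤ × ℤ → ℤ × ℤ × ℤ} (h : ∀ x, f (ofZ x) = ofZ (g x)) :
    B0.map (List.map f) = (B0Z.map (List.map g)).map (List.map ofZ) := by
  rw [B0_eq, List.map_map, List.map_map, List.map_comp_map, List.map_comp_map]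
  exact congrArg (fun k => B0Z.map (List.map k)) (funext h)

lemma exists_blocksZ {i : Fin 4} {M : List (Pt 3)} (hM : M ∈ blockLists i) :
    ∃ L ∈ blocksZ, M = L.map ofZ := by
  have key : ∀ l : List (List (ℤ × ℤ × ℤ)), l ⊆ blocksZ → M ∈ l.map (List.map ofZ) →
      ∃ L ∈ blocksZ, M = L.map ofZ := by
    intro l hl h
    obtain ⟨L, hL, rfl⟩ := List.mem_map.1 h
    exact ⟨L, hl hL, rfl⟩
  fin_cases i
  · exact key B0Z (by intro x hx; simp only [blocksZ, List.mem_append]; tauto) (B0_eq ▸ hM)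
  · refine key (B0Z.map (List.map fun x => (2 + x.1, 2 - x.2.1, -x.2.2)))
      (by intro x hx; simp only [blocksZ, List.mem_append]; tauto) ?_
    rw [← map_B0_eq (f := fun p => p3 2 2 0 + sigma3 p)]
    · exact hM
    · intro x; apply Pt3.ext <;> simp [ofZ, sigma3, toPt3, sub_eq_add_neg]
  · refine key (B0Z.map (List.map fun x => (2 + x.1, x.2.2, 2 - x.2.1)))
      (by intro x hx; simp only [blocksZ, List.mem_append]; tauto) ?_
    rw [← map_B0_eq (f := fun p => p3 2 0 2 + tau3 p)]
    · exact hM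
    · intro x; apply Pt3.ext <;> simp [ofZ, tau3, toPt3, sub_eq_add_neg]
  · refine key (B0Z.map (List.map fun x => (x.1, 2 - x.2.2, 2 + x.2.1)))
      (by intro x hx; simp only [blocksZ, List.mem_append]; tauto) ?_
    rw [← map_B0_eq (f := fun p => p3 0 2 2 + ups3 p)]
    · exact hM
    · intro x; apply Pt3.ext <;> simp [ofZ, ups3, toPt3, sub_eq_add_neg]

/-- The `j`-th vertex of the translate of `L` by `4u`. -/
def vertZ (u : ℤ × ℤ × ℤ) (L : List (ℤ × ℤ × ℤ)) (j : ℕ) : ℤ × ℤ × ℤ := (4 : ℤ) • u + L.getD j 0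

lemma getD_map_ofZ (L : List (ℤ × ℤ × ℤ)) (j : ℕ) :
    (L.map ofZ).getD j 0 = ofZ (L.getD j 0) := by
  rw [← ofZ_zero, List.getD_map]

lemma getD_add_smul (u : ℤ × ℤ × ℤ) (L : List (ℤ × ℤ × ℤ)) (j : ℕ) :
    (L.map ofZ).getD j 0 + (4 : ℝ) • ofZ u = ofZ (vertZ u L j) := by
  rw [getD_map_ofZ, vertZ, ofZ_add, ofZ_smul, add_comm]
  norm_num

lemma mem_CTrace_segs {S : Sym2 (Pt 3)} (hS : S ∈ CTrace.segs) :
    ∃ u, ∃ L ∈ blocksZ, ∃ j, j + 1 < L.length ∧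
      S = s(ofZ (vertZ u L j), ofZ (vertZ u L (j + 1))) := by
  obtain ⟨p, hp, i, M, hM, A, ⟨j, hj, rfl⟩, rfl⟩ := hS
  obtain ⟨u, rfl⟩ := latt_iff_exists_ofZ.1 hp
  obtain ⟨L, hL, rfl⟩ := exists_blocksZ hM
  refine ⟨u, L, hL, j, by simpa using hj, ?_⟩
  rw [Sym2.map_mk, getD_add_smul, getD_add_smul]

lemma CTrace_conn {S T : Sym2 (Pt 3)} (h : CTrace.conn S T) :
    ∃ u, ∃ L ∈ blocksZ, ∃ j k, j + 1 < L.length ∧ k + 1 < L.length ∧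
      S = s(ofZ (vertZ u L j), ofZ (vertZ u L (j + 1))) ∧
      T = s(ofZ (vertZ u L k), ofZ (vertZ u L (k + 1))) := by
  obtain ⟨p, hp, i, M, hM, A, B, ⟨j, hj, h⟩, rfl, rfl⟩ := h
  obtain ⟨u, rfl⟩ := latt_iff_exists_ofZ.1 hp
  obtain ⟨L, hL, rfl⟩ := exists_blocksZ hM
  rw [List.length_map] at hj
  refine ⟨u, L, hL, ?_⟩
  rcases h with ⟨rfl, rfl⟩ | ⟨rfl, rfl⟩
  · refine ⟨j, j + 1, by omega, by omega, ?_, ?_⟩ <;>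
      rw [Sym2.map_mk, getD_add_smul, getD_add_smul]
  · refine ⟨j + 1, j, by omega, by omega, ?_, ?_⟩ <;>
      rw [Sym2.map_mk, getD_add_smul, getD_add_smul]

/-! ### The parent map

A lattice segment is encoded by the sum of its endpoints. -/

def mod8 (m : ℤ × ℤ × ℤ) : ℤ × ℤ × ℤ := (m.1 % 8, m.2.1 % 8, m.2.2 % 8)

def div8 (m : ℤ × ℤ × ℤ) : ℤ × ℤ × ℤ := (m.1 / 8, m.2.1 / 8, m.2.2 / 8)

def half (m : ℤ × ℤ × ℤ) : ℤ × ℤ × ℤ := (m.1 / 2, m.2.1 / 2, m.2.2 / 2)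

/-- For the segment number `j` of the curve `L`: its code modulo `8`, and the halves of the
endpoints of the translate of `L` whose segment has this reduced code. -/
def tableEntry (L : List (ℤ × ℤ × ℤ)) (j : ℕ) :
    (ℤ × ℤ × ℤ) × (ℤ × ℤ × ℤ) × (ℤ × ℤ × ℤ) :=
  (mod8 (L.getD j 0 + L.getD (j + 1) 0),
    half (L.getD 0 0) - (2 : ℤ) • div8 (L.getD j 0 + L.getD (j + 1) 0),
    half (L.getD 8 0) - (2 : ℤ) • div8 (L.getD j 0 + L.getD (j + 1) 0))

def parentTable : List ((ℤ × ℤ × ℤ) × (ℤ × ℤ × ℤ) × (ℤ × ℤ × ℤ)) :=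
  blocksZ.flatMap fun L => (List.range 8).map (tableEntry L)

/-- The halves of the endpoints of the curve of `𝒞` containing the segment with code `m`
(and the endpoints of `[0, e₁]` if `m` is not the code of a segment). -/
def parentEnds (m : ℤ × ℤ × ℤ) : (ℤ × ℤ × ℤ) × (ℤ × ℤ × ℤ) :=
  match parentTable.lookup (mod8 m) with
  | some e => (e.1 + (2 : ℤ) • div8 m, e.2 + (2 : ℤ) • div8 m)
  | none => (0, (1, 0, 0))

/-- The code of the parent of the segment with code `m`. -/
def parent (m : ℤ × ℤ × ℤ) : ℤ × ℤ × ℤ := (parentEnds m).1 + (parentEnds m).2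

lemma blocksZ_length : ∀ L ∈ blocksZ, L.length = 9 := by decide +kernel

lemma lookup_parentTable : ∀ L ∈ blocksZ, ∀ j < 8,
    parentTable.lookup (tableEntry L j).1 = some (tableEntry L j).2 := by
  decide +kernel

lemma half_end_of_even : ∀ L ∈ blocksZ, ∀ j < 9,
    (L.getD j 0 = (2 : ℤ) • half (L.getD j 0)) →
      (j = 0 ∨ j = 8) := by
  decide +kernel

lemma table_bound : ∀ e ∈ parentTable,
    |2 * (e.2.1.1 + e.2.2.1) - e.1.1| ≤ 2 ∧
    |2 * (e.2.1.2.1 + e.2.2.2.1) - e.1.2.1| ≤ 2 ∧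
    |2 * (e.2.1.2.2 + e.2.2.2.2) - e.1.2.2| ≤ 2 := by
  decide +kernel

/-- The codes of the six segments with endpoint `0`. -/
def unitCodes : List (ℤ × ℤ × ℤ) :=
  [(1, 0, 0), (-1, 0, 0), (0, 1, 0), (0, -1, 0), (0, 0, 1), (0, 0, -1)]

lemma parent_iterate_small : ∀ a ∈ List.range 5, ∀ b ∈ List.range 5, ∀ c ∈ List.range 5,
    parent^[3] ((a : ℤ) - 2, (b : ℤ) - 2, (c : ℤ) - 2) ∈ unitCodes := by
  decide +kernel

lemma parentEnds_vertZ (u : ℤ × ℤ × ℤ) {L : List (ℤ × ℤ × ℤ)} (hL : L ∈ blocksZ) {j : ℕ}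
    (hj : j < 8) :
    parentEnds (vertZ u L j + vertZ u L (j + 1)) =
      (half (L.getD 0 0) + (2 : ℤ) • u, half (L.getD 8 0) + (2 : ℤ) • u) := by
  have hsum : vertZ u L j + vertZ u L (j + 1) =
      (8 : ℤ) • u + (L.getD j 0 + L.getD (j + 1) 0) := by
    simp only [vertZ]; module
  have h := lookup_parentTable L hL j hj
  simp only [tableEntry] at h
  rw [hsum]
  set r := L.getD j 0 + L.getD (j + 1) 0
  have hm : mod8 ((8 : ℤ) • u + r) = mod8 r := by
    simp [mod8]
  have hd : div8 ((8 : ℤ) • u + r) = u + div8 r := by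
    refine Prod.ext ?_ (Prod.ext ?_ ?_) <;> simp [div8] <;> omega
  rw [parentEnds, hm, h, hd]
  refine Prod.ext ?_ ?_ <;> simp only <;> module

lemma abs_parent_le {n : ℕ} (hn : 3 ≤ n) {m : ℤ × ℤ × ℤ}
    (h : |m.1| ≤ n ∧ |m.2.1| ≤ n ∧ |m.2.2| ≤ n) :
    |(parent m).1| ≤ (n - 1 : ℕ) ∧ |(parent m).2.1| ≤ (n - 1 : ℕ) ∧
      |(parent m).2.2| ≤ (n - 1 : ℕ) := by
  cases hl : parentTable.lookup (mod8 m) with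
  | none =>
    simp only [parent, parentEnds, hl]
    simp
    omega
  | some e =>
    have hb := table_bound (mod8 m, e) (by
      obtain ⟨l₁, l₂, h, -⟩ := List.lookup_eq_some_iff.1 hl
      rw [h]; simp)
    simp only [mod8, abs_le] at hb h
    simp only [parent, parentEnds, hl, div8, Prod.fst_add, Prod.snd_add, Prod.smul_fst,
      Prod.smul_snd, smul_eq_mul, abs_le]
    omega

lemma exists_parent_iterate_mem (n : ℕ) : ∀ m : ℤ × ℤ × ℤ,
    |m.1| ≤ n ∧ |m.2.1| ≤ n ∧ |m.2.2| ≤ n → ∃ N, parent^[N] m ∈ unitCodes := by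
  induction n using Nat.strong_induction_on with
  | _ n ih =>
    intro m hm
    by_cases hn : 3 ≤ n
    · obtain ⟨N, hN⟩ := ih (n - 1) (by omega) _ (abs_parent_le hn hm)
      exact ⟨N + 1, hN⟩
    · simp only [abs_le] at hm
      have h := parent_iterate_small (m.1 + 2).toNat (by rw [List.mem_range]; omega)
        (m.2.1 + 2).toNat (by rw [List.mem_range]; omega)
        (m.2.2 + 2).toNat (by rw [List.mem_range]; omega)
      rw [Int.toNat_of_nonneg (by omega), Int.toNat_of_nonneg (by omega),
        Int.toNat_of_nonneg (by omega)] at h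
      simp only [add_sub_cancel_right] at h
      exact ⟨3, h⟩

/-- The code of a lattice segment: the sum of its endpoints. -/
def code (S : Sym2 (Pt 3)) : ℤ × ℤ × ℤ :=
  (⌊Sym2.lift ⟨fun p q : Pt 3 => p 0 + q 0, fun _ _ => add_comm _ _⟩ S⌋,
    ⌊Sym2.lift ⟨fun p q : Pt 3 => p 1 + q 1, fun _ _ => add_comm _ _⟩ S⌋,
    ⌊Sym2.lift ⟨fun p q : Pt 3 => p 2 + q 2, fun _ _ => add_comm _ _⟩ S⌋)

lemma code_mk (x y : ℤ × ℤ × ℤ) : code s(ofZ x, ofZ y) = x + y := by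
  simp only [code, Sym2.lift_mk, ofZ, p3_zero, p3_one, p3_two, ← Int.cast_add, Int.floor_intCast]
  rfl

lemma parentEnds_code_eq {S T : Sym2 (Pt 3)} (h : CTrace.conn S T) :
    parentEnds (code S) = parentEnds (code T) := by
  obtain ⟨u, L, hL, j, k, hj, hk, rfl, rfl⟩ := CTrace_conn h
  rw [blocksZ_length L hL] at hj hk
  rw [code_mk, code_mk, parentEnds_vertZ u hL (by omega), parentEnds_vertZ u hL (by omega)]

lemma eq_half_of_vertZ {u : ℤ × ℤ × ℤ} {L : List (ℤ × ℤ × ℤ)} (hL : L ∈ blocksZ) {j : ℕ}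
    (hj : j < 9) {x : ℤ × ℤ × ℤ} (h : ((2 : ℕ) : ℝ) • ofZ x = ofZ (vertZ u L j)) :
    x = half (L.getD 0 0) + (2 : ℤ) • u ∨ x = half (L.getD 8 0) + (2 : ℤ) • u := by
  have h2 : (2 : ℤ) • x = vertZ u L j := by
    apply ofZ_injective
    rw [ofZ_smul, ← h]; norm_num
  have hx : x = half (L.getD j 0) + (2 : ℤ) • u := by
    simp only [vertZ, Prod.ext_iff, Prod.fst_add, Prod.snd_add, Prod.smul_fst, Prod.smul_snd,
      smul_eq_mul, half] at h2 ⊢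
    omega
  have heven : L.getD j 0 = (2 : ℤ) • half (L.getD j 0) := by
    simp only [vertZ, Prod.ext_iff, Prod.fst_add, Prod.snd_add, Prod.smul_fst, Prod.smul_snd,
      smul_eq_mul, half] at h2 ⊢
    omega
  rcases half_end_of_even L hL j hj heven with rfl | rfl
  exacts [.inl hx, .inr hx]

lemma eq_parentEnds_of_mem {S : Sym2 (Pt 3)} (hS : S ∈ CTrace.segs) {x : ℤ × ℤ × ℤ}
    (hx : ((2 : ℕ) : ℝ) • ofZ x ∈ S) :
    x = (parentEnds (code S)).1 ∨ x = (parentEnds (code S)).2 := by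
  obtain ⟨u, L, hL, j, hj, rfl⟩ := mem_CTrace_segs hS
  rw [blocksZ_length L hL] at hj
  rw [code_mk, parentEnds_vertZ u hL (by omega)]
  rcases Sym2.mem_iff.1 hx with h | h
  · exact eq_half_of_vertZ hL (by omega) h
  · exact eq_half_of_vertZ hL (by omega) h

/-! ### Curves and connexions -/

namespace Curve

variable {n : ℕ} {c : Curve n}

lemma conn_comm {S T : Sym2 (Pt n)} (h : c.conn S T) : c.conn T S := by
  obtain ⟨i, h1, h2, h⟩ := h
  exact ⟨i, h1, h2, h.symm⟩

lemma left_mem_of_conn {S T : Sym2 (Pt n)} (h : c.conn S T) : S ∈ c.segs := by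
  obtain ⟨i, h1, h2, h⟩ := h
  have hi : i ∈ c.dom := c.ordConn.out h1 h2 ⟨by omega, by omega⟩
  rcases h with ⟨rfl, -⟩ | ⟨-, rfl⟩
  · exact ⟨i - 1, h1, by simpa using hi, by simp⟩
  · exact ⟨i, hi, h2, rfl⟩

/-- A property transmitted by the connexions of a curve holds for all its segments as soon as it
holds for one of them. -/
lemma segs_induction {p : Sym2 (Pt n) → Prop} {S T : Sym2 (Pt n)} (hS : S ∈ c.segs)
    (hT : T ∈ c.segs) (hp : p S) (step : ∀ S T, c.conn S T → p S → p T) : p T := by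
  obtain ⟨i, hi, hi', rfl⟩ := hS
  obtain ⟨j, hj, hj', rfl⟩ := hT
  have key : ∀ k, k + 1 ∈ c.dom → k + 1 + 1 ∈ c.dom → k ∈ c.dom →
      c.conn s(c.v k, c.v (k + 1)) s(c.v (k + 1), c.v (k + 1 + 1)) := fun k _ h2 h0 =>
    ⟨k + 1, by simpa using h0, h2, .inl ⟨by simp, rfl⟩⟩
  rcases le_total i j with h | h
  · induction j, h using Int.leInduction with
    | base => exact hp
    | succ j h ih =>
      have hj0 : j ∈ c.dom := c.ordConn.out hi hj ⟨h, by omega⟩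
      exact step _ _ (key j hj hj' hj0) (ih hj0 hj)
  · induction j, h using Int.leInductionDown with
    | base => exact hp
    | pred j h ih =>
      have hj0 : j ∈ c.dom := by simpa using hj'
      have e : j - 1 + 1 = j := by omega
      have hj1 : j + 1 ∈ c.dom := c.ordConn.out hj0 hi' ⟨by omega, by omega⟩
      refine step _ _ (conn_comm ?_) (ih hj0 hj1)
      have := key (j - 1) (by rwa [e]) (by rwa [e]) hj
      simpa only [e] using this

lemma segs_shape {x y : Pt n} (h : s(x, y) ∈ c.segs) :
    ∃ w j, latt w ∧ (x = w ∧ y = w + uvec n j ∨ x = w + uvec n j ∧ y = w) := by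
  obtain ⟨i, hi, hi', h⟩ := h
  obtain ⟨j, hj⟩ := c.step i hi hi'
  have hshape : ∃ w, latt w ∧ (c.v i = w ∧ c.v (i + 1) = w + uvec n j ∨
      c.v i = w + uvec n j ∧ c.v (i + 1) = w) := by
    rcases hj with hj | hj
    · exact ⟨_, c.lattice i hi, .inl ⟨rfl, hj⟩⟩
    · exact ⟨_, c.lattice _ hi', .inr ⟨by rw [hj]; abel, rfl⟩⟩
  obtain ⟨w, hw, hc⟩ := hshape
  refine ⟨w, j, hw, ?_⟩
  rcases Sym2.eq_iff.1 h with ⟨rfl, rfl⟩ | ⟨rfl, rfl⟩ <;> tauto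

lemma exists_segs (c : Curve n) : ∃ S, S ∈ c.segs := by
  obtain ⟨i, hi, hi'⟩ := c.nontriv
  exact ⟨_, i, hi, hi', rfl⟩

lemma endSegAt_mem {p : Pt n} {S : Sym2 (Pt n)} (h : c.endSegAt p S) : S ∈ c.segs ∧ p ∈ S := by
  obtain ⟨i, hi, rfl, ⟨-, h, rfl⟩ | ⟨-, h, rfl⟩⟩ := h
  · exact ⟨⟨i, hi, h, rfl⟩, by simp⟩
  · exact ⟨⟨i - 1, h, by simpa using hi, by simp⟩, by simp⟩

lemma IsEndpt.exists_endSegAt {p : Pt n} (h : c.IsEndpt p) : ∃ S, c.endSegAt p S := by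
  obtain ⟨i, hi, rfl, h⟩ := h
  obtain ⟨k, hk, hk'⟩ := c.nontriv
  have : (i - 1 ∉ c.dom ∧ i + 1 ∈ c.dom) ∨ (i + 1 ∉ c.dom ∧ i - 1 ∈ c.dom) := by
    rcases h with h | h
    · refine .inl ⟨h, ?_⟩
      have hik : i ≤ k := by
        by_contra hlt
        exact h (c.ordConn.out hk hi ⟨by omega, by omega⟩)
      exact c.ordConn.out hi hk' ⟨by omega, by omega⟩
    · refine .inr ⟨h, ?_⟩
      have hik : k + 1 ≤ i := by
        by_contra hlt
        exact h (c.ordConn.out hi hk' ⟨by omega, by omega⟩)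
      exact c.ordConn.out hk hi ⟨by omega, by omega⟩
  rcases this with ⟨h1, h2⟩ | ⟨h1, h2⟩
  · exact ⟨_, i, hi, rfl, .inl ⟨h1, h2, rfl⟩⟩
  · exact ⟨_, i, hi, rfl, .inr ⟨h1, h2, rfl⟩⟩

end Curve

lemma DisjSA.sameCurve {n : ℕ} {E : Set (Curve n)} (hE : DisjSA E) {c d : Curve n} (hc : c ∈ E)
    (hd : d ∈ E) {S : Sym2 (Pt n)} (hSc : S ∈ c.segs) (hSd : S ∈ d.segs) : SameCurve c d := by
  by_contra h
  exact hE.2 c hc d hd h S hSc hSd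

/-- `S` and `T` are segments of the same curve of `E`. -/
def OnSameCurve {n : ℕ} (E : Set (Curve n)) (S T : Sym2 (Pt n)) : Prop :=
  ∃ c ∈ E, S ∈ c.segs ∧ T ∈ c.segs

lemma OnSameCurve.trans {n : ℕ} {E : Set (Curve n)} (hE : DisjSA E) {S T U : Sym2 (Pt n)}
    (h : OnSameCurve E S T) (h' : OnSameCurve E T U) : OnSameCurve E S U := by
  obtain ⟨c, hc, hS, hT⟩ := h
  obtain ⟨d, hd, hT', hU⟩ := h'
  exact ⟨c, hc, hS, (hE.sameCurve hc hd hT hT').1 ▸ hU⟩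

lemma onSameCurve_of_conn {n : ℕ} {E : Set (Curve n)} {S T : Sym2 (Pt n)}
    (h : (traceOf E).conn S T) : OnSameCurve E S T := by
  obtain ⟨c, hc, h⟩ := h
  exact ⟨c, hc, Curve.left_mem_of_conn h, Curve.left_mem_of_conn (Curve.conn_comm h)⟩

/-! ### Curves of the covering over a segment -/

/-- The curve `c` of `A` has the endpoints `k • x` and `k • y`. -/
def Over {n : ℕ} (k : ℕ) (A : Set (Curve n)) (x y : Pt n) (c : Curve n) : Prop :=
  c ∈ A ∧ c.IsEndpt ((k : ℝ) • x) ∧ c.IsEndpt ((k : ℝ) • y)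

lemma Over.swap {n k : ℕ} {A : Set (Curve n)} {x y : Pt n} {c : Curve n} (h : Over k A x y c) :
    Over k A y x c := ⟨h.1, h.2.2, h.2.1⟩

lemma SatH.exists_over {n k l : ℕ} {A : Set (Curve n)} (hA : SatH A k l) {d : Curve n}
    {x y : Pt n} (h : s(x, y) ∈ d.segs) :
    (∃ c, Over k A x y c) ∧ ∀ c c', Over k A x y c → Over k A x y c' → SameCurve c c' := by
  have key : ∀ w j, latt w → (∃ c, Over k A w (w + uvec n j) c) ∧
      ∀ c c', Over k A w (w + uvec n j) c → Over k A w (w + uvec n j) c' → SameCurve c c' := by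
    intro w j hw
    have hin : inLat k ((k : ℝ) • w) := fun i => by
      obtain ⟨m, hm⟩ := hw i
      exact ⟨m, by simp [hm]⟩
    have hlatt : latt ((k : ℝ) • w) := fun i => by
      obtain ⟨m, hm⟩ := hw i
      exact ⟨k * m, by simp [hm]⟩
    obtain ⟨⟨c, hc, h1, h2⟩, huniq⟩ := hA.2.2.2.2.2.1 _ j hlatt hin
    simp only [Over, smul_add]
    exact ⟨⟨c, hc, h1, h2⟩, fun c c' hc hc' =>
      huniq c hc.1 c' hc'.1 hc.2.1 hc.2.2 hc'.2.1 hc'.2.2⟩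
  obtain ⟨w, j, hw, ⟨rfl, rfl⟩ | ⟨rfl, rfl⟩⟩ := Curve.segs_shape h
  · exact key _ j hw
  · obtain ⟨⟨c, hc⟩, huniq⟩ := key _ j hw
    exact ⟨⟨c, hc.swap⟩, fun c c' hc hc' => huniq c c' hc.swap hc'.swap⟩

section Conv

variable {n k l : ℕ} {A E F : Set (Curve n)}

lemma onSameCurve_of_over (hE : DisjSA E) (hEF : traceOf E = ConvTrace k A F) {x y : Pt n}
    (hxy : s(x, y) ∈ (traceOf F).segs) {c : Curve n} (hc : Over k A x y c) {S T : Sym2 (Pt n)}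
    (hS : S ∈ c.segs) (hT : T ∈ c.segs) : OnSameCurve E S T := by
  refine Curve.segs_induction (p := OnSameCurve E S) hS hT ?_ ?_
  · have : S ∈ (traceOf E).segs := by
      rw [hEF]; exact ⟨x, y, hxy, c, hc.1, hc.2.1, hc.2.2, hS⟩
    obtain ⟨d, hd, hSd⟩ := this
    exact ⟨d, hd, hSd, hSd⟩
  · intro U V hUV h
    refine h.trans hE (onSameCurve_of_conn ?_)
    rw [hEF]
    exact .inl ⟨x, y, hxy, c, hc.1, hc.2.1, hc.2.2, hUV⟩

/-- If two segments are on the same curve of `F`, then the curves of `A` that replace them are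
parts of the same curve of `A ∗ F`. -/
lemma onSameCurve_of_onSameCurve_over (hA : SatH A k l) (hE : DisjSA E)
    (hEF : traceOf E = ConvTrace k A F) {a a' b b' : Pt n}
    (h : OnSameCurve F s(a, a') s(b, b')) {c c' : Curve n} (hc : Over k A a a' c)
    (hc' : Over k A b b' c') {S T : Sym2 (Pt n)} (hS : S ∈ c.segs) (hT : T ∈ c'.segs) :
    OnSameCurve E S T := by
  obtain ⟨d, hd, hP, hQ⟩ := h
  refine Curve.segs_induction (c := d) (p := fun Q => ∀ b b', Q = s(b, b') →
    ∀ c', Over k A b b' c' → ∀ T ∈ c'.segs, OnSameCurve E S T) hP hQ ?_ ?_ b b' rfl c' hc' T hT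
  · intro b b' hb c' hc' T hT
    have hc'' : Over k A a a' c' := by
      rcases Sym2.eq_iff.1 hb with ⟨rfl, rfl⟩ | ⟨rfl, rfl⟩
      exacts [hc', hc'.swap]
    have := (hA.exists_over hP).2 _ _ hc hc''
    exact onSameCurve_of_over hE hEF ⟨d, hd, hP⟩ hc'' (this.1 ▸ hS) hT
  · intro Q Q' hQQ ih b b' hb c' hc' T hT
    have hshape : ∃ x y z, Q = s(x, y) ∧ Q' = s(y, z) := by
      obtain ⟨i, -, -, ⟨rfl, rfl⟩ | ⟨rfl, rfl⟩⟩ := hQQ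
      exacts [⟨_, _, _, rfl, rfl⟩, ⟨_, _, _, Sym2.eq_swap, Sym2.eq_swap⟩]
    obtain ⟨x, y, z, rfl, rfl⟩ := hshape
    have hc'' : Over k A y z c' := by
      rcases Sym2.eq_iff.1 hb with ⟨rfl, rfl⟩ | ⟨rfl, rfl⟩
      exacts [hc', hc'.swap]
    obtain ⟨⟨c₁, hc₁⟩, -⟩ := hA.exists_over (Curve.left_mem_of_conn hQQ)
    obtain ⟨U, hU⟩ := hc₁.2.2.exists_endSegAt
    obtain ⟨V, hV⟩ := hc''.2.1.exists_endSegAt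
    have hUV : OnSameCurve E U V := by
      apply onSameCurve_of_conn
      rw [hEF]
      exact .inr ⟨x, y, z, ⟨d, hd, hQQ⟩, c₁, hc₁.1, c', hc''.1, hc₁.2.1, hc₁.2.2, hc''.2.1,
        hc''.2.2, .inl ⟨hU, hV⟩⟩
    have hSU := ih x y rfl c₁ hc₁ U (Curve.endSegAt_mem hU).1
    exact (hSU.trans hE hUV).trans hE (onSameCurve_of_over hE hEF
      ⟨d, hd, Curve.left_mem_of_conn (Curve.conn_comm hQQ)⟩ hc'' (Curve.endSegAt_mem hV).1 hT)

end Conv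

/-! ### Every curve passes through the origin -/

lemma uvec_eq_ofZ (j : Fin 3) : ∃ e ∈ unitCodes, -e ∈ unitCodes ∧ uvec 3 j = ofZ e := by
  fin_cases j
  · exact ⟨(1, 0, 0), by decide, by decide, by apply Pt3.ext <;> simp [uvec, ofZ]⟩
  · exact ⟨(0, 1, 0), by decide, by decide, by apply Pt3.ext <;> simp [uvec, ofZ]⟩
  · exact ⟨(0, 0, 1), by decide, by decide, by apply Pt3.ext <;> simp [uvec, ofZ]⟩

lemma segs_shape_ofZ {c : Curve 3} {S : Sym2 (Pt 3)} (h : S ∈ c.segs) :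
    ∃ x, ∃ e ∈ unitCodes, -e ∈ unitCodes ∧ S = s(ofZ x, ofZ (x + e)) := by
  induction S using Sym2.ind with
  | _ p q =>
    obtain ⟨w, j, hw, h⟩ := Curve.segs_shape h
    obtain ⟨x, rfl⟩ := latt_iff_exists_ofZ.1 hw
    obtain ⟨e, he, he', hj⟩ := uvec_eq_ofZ j
    rw [hj, ← ofZ_add] at h
    refine ⟨x, e, he, he', ?_⟩
    rcases h with ⟨rfl, rfl⟩ | ⟨rfl, rfl⟩
    exacts [rfl, Sym2.eq_swap]

lemma eq_zero_or_of_mem_unitCodes : ∀ e ∈ unitCodes, ∀ f ∈ unitCodes, ∀ x : ℤ × ℤ × ℤ,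
    x + (x + e) = f → x = 0 ∨ x = -e := by
  intro e he f hf x h
  simp only [unitCodes, List.mem_cons, List.not_mem_nil, or_false] at he hf
  rcases he with rfl | rfl | rfl | rfl | rfl | rfl <;>
  rcases hf with rfl | rfl | rfl | rfl | rfl | rfl <;>
  simp only [Prod.ext_iff, Prod.fst_add, Prod.snd_add, Prod.fst_zero, Prod.snd_zero,
    Prod.fst_neg, Prod.snd_neg] at h ⊢ <;> omega

/-- `S` is one of the six segments with endpoint `0`. -/
def IsUnitSeg (S : Sym2 (Pt 3)) : Prop := ∃ e ∈ unitCodes, S = s(0, ofZ e)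

lemma isUnitSeg_of_shape {x e : ℤ × ℤ × ℤ} (he : e ∈ unitCodes) (he' : -e ∈ unitCodes)
    (hx : x = 0 ∨ x = -e) : IsUnitSeg s(ofZ x, ofZ (x + e)) := by
  rcases hx with rfl | rfl
  · exact ⟨e, he, by rw [zero_add, ofZ_zero]⟩
  · exact ⟨-e, he', by rw [neg_add_cancel, ofZ_zero, Sym2.eq_swap]⟩

lemma isUnitSeg_of_code {c : Curve 3} {S : Sym2 (Pt 3)} (h : S ∈ c.segs)
    (hS : code S ∈ unitCodes) : IsUnitSeg S := by
  obtain ⟨x, e, he, he', rfl⟩ := segs_shape_ofZ h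
  rw [code_mk] at hS
  exact isUnitSeg_of_shape he he' (eq_zero_or_of_mem_unitCodes e he _ hS x rfl)

lemma isUnitSeg_of_zero_mem {c : Curve 3} {S : Sym2 (Pt 3)} (h : S ∈ c.segs) (hS : 0 ∈ S) :
    IsUnitSeg S := by
  obtain ⟨x, e, he, he', rfl⟩ := segs_shape_ofZ h
  rw [Sym2.mem_iff, ← ofZ_zero, ofZ_injective.eq_iff, ofZ_injective.eq_iff] at hS
  refine isUnitSeg_of_shape he he' (hS.imp Eq.symm fun h => ?_)
  exact eq_neg_of_add_eq_zero_left h.symm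

lemma ne_of_mem_segs {c : Curve 3} {x y : ℤ × ℤ × ℤ} (h : s(ofZ x, ofZ y) ∈ c.segs) : x ≠ y := by
  rintro rfl
  obtain ⟨w, j, -, h⟩ := Curve.segs_shape h
  have : uvec 3 j = 0 := by
    rcases h with ⟨rfl, h⟩ | ⟨h, rfl⟩ <;> simpa using h
  simpa [uvec] using congrArg (fun p : Pt 3 => p j) this

lemma code_eq_parent {C3 : Set (Curve 3)} (hC3 : traceOf C3 = CTrace) {d : Curve 3} {p q : Pt 3}
    (hpq : s(p, q) ∈ d.segs) {c : Curve 3} (hc : Over 2 C3 p q c) {S : Sym2 (Pt 3)}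
    (hS : S ∈ c.segs) : code s(p, q) = parent (code S) := by
  obtain ⟨x, y, rfl, rfl⟩ : ∃ x y, p = ofZ x ∧ q = ofZ y := by
    obtain ⟨x, e, -, -, h⟩ := segs_shape_ofZ hpq
    rcases Sym2.eq_iff.1 h with ⟨rfl, rfl⟩ | ⟨rfl, rfl⟩
    exacts [⟨_, _, rfl, rfl⟩, ⟨_, _, rfl, rfl⟩]
  have hne := ne_of_mem_segs hpq
  have key : ∀ z, c.IsEndpt (((2 : ℕ) : ℝ) • ofZ z) →
      z = (parentEnds (code S)).1 ∨ z = (parentEnds (code S)).2 := by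
    intro z hz
    obtain ⟨U, hU⟩ := hz.exists_endSegAt
    obtain ⟨hU, hzU⟩ := Curve.endSegAt_mem hU
    have hSU : parentEnds (code S) = parentEnds (code U) := by
      refine Curve.segs_induction (p := fun U => parentEnds (code S) = parentEnds (code U))
        hS hU rfl fun V W hVW h => h.trans (parentEnds_code_eq ?_)
      rw [← hC3]
      exact ⟨c, hc.1, hVW⟩
    rw [hSU]
    refine eq_parentEnds_of_mem ?_ hzU
    rw [← hC3]
    exact ⟨c, hc.1, hU⟩
  rw [code_mk, parent]
  rcases key x hc.2.1 with h1 | h1 <;> rcases key y hc.2.2 with h2 | h2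
  · exact absurd (h1.trans h2.symm) hne
  · rw [h1, h2]
  · rw [h1, h2, add_comm]
  · exact absurd (h1.trans h2.symm) hne

lemma exists_isUnitSeg {C3 : Set (Curve 3)} (hC3 : traceOf C3 = CTrace) (hH : SatH C3 2 4)
    {D : ℕ → Set (Curve 3)} (hD : ∀ m, DisjSA (D m))
    (hchain : ∀ m, traceOf (D m) = ConvTrace 2 C3 (D (m + 1))) (N : ℕ) :
    ∀ m, ∀ S ∈ (traceOf (D m)).segs, parent^[N] (code S) ∈ unitCodes →
      ∃ T, IsUnitSeg T ∧ OnSameCurve (D m) S T := by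
  induction N with
  | zero =>
    rintro m S ⟨c, hc, hS⟩ h
    exact ⟨S, isUnitSeg_of_code hS h, c, hc, hS, hS⟩
  | succ N ih =>
    intro m S hS h
    rw [hchain m] at hS
    obtain ⟨a, b, hab, c, hc, ha, hb, hS⟩ := hS
    have hover : Over 2 C3 a b c := ⟨hc, ha, hb⟩
    obtain ⟨d, hd, hab'⟩ := hab
    rw [Function.iterate_succ_apply, ← code_eq_parent hC3 hab' hover hS] at h
    obtain ⟨T, ⟨e, he, rfl⟩, hT⟩ := ih (m + 1) _ ⟨d, hd, hab'⟩ h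
    obtain ⟨d', -, -, hT'⟩ := id hT
    obtain ⟨⟨c', hc'⟩, -⟩ := hH.exists_over hT'
    obtain ⟨U, hU⟩ := hc'.2.1.exists_endSegAt
    obtain ⟨hU, h0⟩ := Curve.endSegAt_mem hU
    rw [smul_zero] at h0
    exact ⟨U, isUnitSeg_of_zero_mem hU h0,
      onSameCurve_of_onSameCurve_over hH (hD m) (hchain m) hT hover hc' hS hU⟩

lemma atMost_of_forall_exists_mem {n : ℕ} {E : Set (Curve n)} (hE : DisjSA E)
    (l : List (Sym2 (Pt n))) (h : ∀ c ∈ E, ∃ S ∈ l, S ∈ c.segs) : AtMost E l.length := by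
  classical
  refine ⟨l.filterMap fun S => if hS : ∃ c ∈ E, S ∈ c.segs then some hS.choose else none,
    List.length_filterMap_le _ _, fun c hc => ?_⟩
  obtain ⟨S, hSl, hSc⟩ := h c hc
  have hS : ∃ c ∈ E, S ∈ c.segs := ⟨c, hc, hSc⟩
  refine ⟨hS.choose, List.mem_filterMap.2 ⟨S, hSl, dif_pos hS⟩, ?_⟩
  exact hE.sameCurve hc hS.choose_spec.1 hSc hS.choose_spec.2

/-- Corollary 2.11: if `𝒟` is a set of curves without endpoints such
that `Γⁿ(𝒟)` is defined for each `n ∈ ℕ`, then `𝒟` consists of at most `27` curves. -/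
theorem statement18 (C3 : Set (Curve 3)) (hC3 : traceOf C3 = CTrace)
    (hH : SatH C3 2 4)
    (Dset : Set (Curve 3)) (hne : ∀ c ∈ Dset, c.NoEndpts) (hdisj : DisjSA Dset)
    (D : ℕ → Set (Curve 3)) (hD0 : D 0 = Dset)
    (hchain : ∀ m : ℕ, DisjSA (D (m + 1)) ∧
      traceOf (D m) = ConvTrace 2 C3 (D (m + 1))) :
    AtMost Dset 27 := by
  have hD : ∀ m, DisjSA (D m) := by
    rintro (_ | m)
    exacts [hD0 ▸ hdisj, (hchain m).1]
  have hmem : ∀ c ∈ Dset, ∃ S ∈ unitCodes.map fun e => s(0, ofZ e), S ∈ c.segs := by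
    intro c hc
    obtain ⟨S, hS⟩ := c.exists_segs
    obtain ⟨N, hN⟩ := exists_parent_iterate_mem
      (max (code S).1.natAbs (max (code S).2.1.natAbs (code S).2.2.natAbs)) (code S)
      (by simp only [Int.abs_eq_natAbs]; omega)
    obtain ⟨T, ⟨e, he, rfl⟩, d, hd, hSd, hT⟩ := exists_isUnitSeg hC3 hH hD
      (fun m => (hchain m).2) N 0 S ⟨c, hD0 ▸ hc, hS⟩ hN
    refine ⟨_, List.mem_map.2 ⟨e, he, rfl⟩, ?_⟩
    rwa [(hdisj.sameCurve hc (hD0 ▸ hd) hS hSd).1]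
  obtain ⟨L, hL, h⟩ := atMost_of_forall_exists_mem hdisj _ hmem
  exact ⟨L, hL.trans (by simp [unitCodes]), h⟩

end
end Folding
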